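/- arXiv:1405.5289 — 3 statements merged into one kernel-verified Lean document; each statement's English description precedes it below -/
import Mathlib

section
/- Let p be a prime, G a finite p-group, and set h₁(G) := r_p(H^1(G, 𝔽_p)) where 𝔽_p = ℤ/pℤ carries the trivial G-action. Let M be a G-module that is a p-primary torsion abelian group, and suppose D is a G-submodule of M such that multiplication by p is surjective on D, D[p] is finite of order p^r, and M/D is finite of order p^t. Then H^1(G, M)[p] is finite and r_p(H^1(G, M)) ≤ h₁(G)·(r + t). -/
/-!
STATEMENT 9: Let p be a prime, G a finite p-group, and set h₁(G) := r_p(H^1(G, 𝔽_p))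
where 𝔽_p = ℤ/pℤ carries the trivial G-action.  Let M be a G-module that is a p-primary
torsion abelian group, and suppose D is a G-submodule of M such that multiplication by p
is surjective on D, D[p] is finite of order p^r, and M/D is finite of order p^t.
Then H^1(G, M)[p] is finite and r_p(H^1(G, M)) ≤ h₁(G)·(r + t).
-/

open groupCohomology

/-- `r_p(N)`: the 𝔽_p-dimension of the p-torsion subgroup `N[p]` of `N`. -/
noncomputable def rp (p : ℕ) (N : Type*) [AddCommGroup N] : ℕ :=
  letI := AddSubgroup.torsionBy.zmodModule (A := N) (n := p)
  Module.finrank (ZMod p) (AddSubgroup.torsionBy N p)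

/-! ### Torsion in abelian groups -/

lemma AddMonoidHom.finite_of_finite_ker_of_finite_range {X Y : Type*} [AddGroup X] [AddGroup Y]
    (f : X →+ Y) (hk : Finite f.ker) (hr : Finite f.range) : Finite X := by
  apply Nat.finite_of_card_ne_zero
  rw [← f.ker.index_mul_card, AddSubgroup.index_ker]
  exact mul_ne_zero Nat.card_pos.ne' Nat.card_pos.ne'

lemma AddSubgroup.mem_torsionBy_natCast {N : Type*} [AddCommGroup N] {p : ℕ} {x : N} :
    x ∈ AddSubgroup.torsionBy N (p : ℤ) ↔ p • x = 0 := by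
  rw [← natCast_zsmul]; rfl

lemma AddSubgroup.card_torsionBy_eq_index_range {N : Type*} [AddCommGroup N] [Finite N] (p : ℕ) :
    Nat.card (AddSubgroup.torsionBy N (p : ℤ)) = (nsmulAddMonoidHom (α := N) p).range.index := by
  have h : AddSubgroup.torsionBy N (p : ℤ) = (nsmulAddMonoidHom (α := N) p).ker := by
    ext x
    rw [AddSubgroup.mem_torsionBy_natCast]; rfl
  rw [h]
  have h1 := (nsmulAddMonoidHom (α := N) p).range.index_mul_card
  rw [← (nsmulAddMonoidHom (α := N) p).ker.index_mul_card, AddSubgroup.index_ker, mul_comm] at h1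
  exact (Nat.eq_of_mul_eq_mul_left Nat.card_pos h1).symm

lemma AddSubgroup.card_torsionBy_le_of_surjective {X R : Type*} [AddCommGroup X] [AddCommGroup R]
    [Finite X] (p : ℕ) (f : X →+ R) (hf : Function.Surjective f) :
    Nat.card (AddSubgroup.torsionBy R (p : ℤ)) ≤ Nat.card (AddSubgroup.torsionBy X (p : ℤ)) := by
  have : Finite R := Finite.of_surjective f hf
  rw [card_torsionBy_eq_index_range, card_torsionBy_eq_index_range]
  have h : (nsmulAddMonoidHom (α := X) p).range.map f = (nsmulAddMonoidHom (α := R) p).range := by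
    ext y
    constructor
    · rintro ⟨_, ⟨x, rfl⟩, rfl⟩
      exact ⟨f x, by simp⟩
    · rintro ⟨z, rfl⟩
      obtain ⟨x, rfl⟩ := hf z
      exact ⟨_, ⟨x, rfl⟩, by simp⟩
  rw [← h]
  exact Nat.le_of_dvd (Nat.pos_of_ne_zero AddSubgroup.index_ne_zero_of_finite)
    (AddSubgroup.index_map_dvd _ hf)

lemma AddMonoidHom.finite_and_card_torsionBy_le_of_exact {X Y Z : Type*} [AddCommGroup X]
    [AddCommGroup Y] [AddCommGroup Z] [Finite X] [Finite Z] (p : ℕ) (f : X →+ Y) (g : Y →+ Z)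
    (h : g.ker ≤ f.range) :
    Finite Y ∧ Nat.card (AddSubgroup.torsionBy Y (p : ℤ)) ≤
      Nat.card (AddSubgroup.torsionBy X (p : ℤ)) * Nat.card (AddSubgroup.torsionBy Z (p : ℤ)) := by
  have hfr : Finite f.range := Finite.of_surjective _ f.rangeRestrict_surjective
  have hY : Finite Y := g.finite_of_finite_ker_of_finite_range
    (Finite.of_injective _ (AddSubgroup.inclusion_injective h)) inferInstance
  refine ⟨hY, ?_⟩
  let T := AddSubgroup.torsionBy Y (p : ℤ)
  let gT : T →+ AddSubgroup.torsionBy Z (p : ℤ) :=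
    (g.comp T.subtype).codRestrict _ fun x ↦ by
      have hx := AddSubgroup.mem_torsionBy_natCast.1 x.2
      rw [AddSubgroup.mem_torsionBy_natCast]
      simp [← map_nsmul, hx]
  let e : gT.ker → AddSubgroup.torsionBy f.range (p : ℤ) := fun x ↦
    ⟨⟨x.1.1, h (congrArg Subtype.val x.2)⟩, AddSubgroup.mem_torsionBy_natCast.2
      (Subtype.ext (AddSubgroup.mem_torsionBy_natCast.1 x.1.2))⟩
  have he : Function.Injective e := fun x y hxy ↦
    Subtype.ext (Subtype.ext (congrArg (fun z ↦ z.1.1) hxy))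
  rw [← gT.ker.index_mul_card, AddSubgroup.index_ker, mul_comm]
  exact Nat.mul_le_mul ((Nat.card_le_card_of_injective e he).trans
    (AddSubgroup.card_torsionBy_le_of_surjective p _ f.rangeRestrict_surjective))
    (Nat.card_le_card_of_injective _ Subtype.val_injective)

lemma AddSubgroup.finite_torsionBy_pow {N : Type*} [AddCommGroup N] (p : ℕ)
    (h : Finite (AddSubgroup.torsionBy N (p : ℤ))) (k : ℕ) :
    Finite (AddSubgroup.torsionBy N ((p ^ k : ℕ) : ℤ)) := by
  induction k with
  | zero =>
    have : Subsingleton (AddSubgroup.torsionBy N ((p ^ 0 : ℕ) : ℤ)) := by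
      refine ⟨fun x y ↦ Subtype.ext ?_⟩
      have hx := AddSubgroup.mem_torsionBy_natCast.1 x.2
      have hy := AddSubgroup.mem_torsionBy_natCast.1 y.2
      simp only [pow_zero, one_smul] at hx hy
      rw [hx, hy]
    infer_instance
  | succ k ih =>
    let f : AddSubgroup.torsionBy N ((p ^ (k + 1) : ℕ) : ℤ) →+
        AddSubgroup.torsionBy N ((p ^ k : ℕ) : ℤ) :=
      ((nsmulAddMonoidHom p).comp (AddSubgroup.subtype _)).codRestrict _ fun x ↦ by
        have hx := AddSubgroup.mem_torsionBy_natCast.1 x.2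
        rw [AddSubgroup.mem_torsionBy_natCast]
        simpa [pow_succ, mul_smul] using hx
    refine f.finite_of_finite_ker_of_finite_range ?_ inferInstance
    let e : f.ker → AddSubgroup.torsionBy N (p : ℤ) := fun x ↦
      ⟨x.1.1, AddSubgroup.mem_torsionBy_natCast.2 (congrArg Subtype.val x.2)⟩
    exact Finite.of_injective e fun x y hxy ↦
      Subtype.ext (Subtype.ext (congrArg (fun z ↦ z.1) hxy))

lemma card_torsionBy_eq_pow_rp (p : ℕ) [Fact p.Prime] (N : Type*) [AddCommGroup N]
    [Finite (AddSubgroup.torsionBy N (p : ℤ))] :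
    Nat.card (AddSubgroup.torsionBy N (p : ℤ)) = p ^ rp p N := by
  let := AddSubgroup.torsionBy.zmodModule (A := N) (n := p)
  rw [Module.natCard_eq_pow_finrank (K := ZMod p), Nat.card_zmod]
  rfl

/-- An additive subgroup, as a `ℤ`-submodule for a given `ℤ`-module structure. -/
def AddSubgroup.toSubmoduleInt {V : Type*} [AddCommGroup V] [Module ℤ V] (D : AddSubgroup V) :
    Submodule ℤ V :=
  { D with
    smul_mem' := fun n x hx ↦
      Set.mem_of_eq_of_mem (int_smul_eq_zsmul inferInstance n x) (D.zsmul_mem hx n) }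

/-! ### First cohomology groups -/

namespace groupCohomology

/-- The structure of a representation over `ℤ`, to be preferred to `AddCommGroup.toIntModule`. -/
abbrev intModule {G : Type} [Group G] (M : Rep ℤ G) : Module ℤ M := M.hV2

attribute [local instance] intModule

variable {G : Type} [Group G] {A B M : Rep ℤ G}

lemma cocycles₁_map_mul (f : cocycles₁ M) (g h : G) : f (g * h) = M.ρ g (f h) + f g :=
  (mem_cocycles₁_iff _).1 f.2 g h

lemma exists_H1π_eq (y : groupCohomology M 1) : ∃ f : cocycles₁ M, H1π M f = y :=
  (ModuleCat.epi_iff_surjective (H1π M)).1 inferInstance y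

lemma H1π_eq_zero_iff_exists (f : cocycles₁ M) :
    H1π M f = 0 ↔ ∃ x : M, ∀ g, f g = M.ρ g x - x := by
  rw [H1π_eq_zero_iff]
  exact ⟨fun ⟨x, hx⟩ ↦ ⟨x, fun g ↦ (congrFun hx g).symm⟩,
    fun ⟨x, hx⟩ ↦ ⟨x, funext fun g ↦ (hx g).symm⟩⟩

/-- The map on first cohomology induced by a morphism of representations. -/
noncomputable def H1map (φ : A ⟶ B) : groupCohomology A 1 →+ groupCohomology B 1 :=
  (map (MonoidHom.id G) φ 1).hom.toAddMonoidHom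

lemma H1map_H1π (φ : A ⟶ B) (f : cocycles₁ A) :
    H1map φ (H1π A f) = H1π B (mapCocycles₁ (MonoidHom.id G) φ f) :=
  H1π_comp_map_apply (MonoidHom.id G) φ f

lemma mapCocycles₁_id_apply (φ : A ⟶ B) (f : cocycles₁ A) (g : G) :
    mapCocycles₁ (MonoidHom.id G) φ f g = φ.hom (f g) := rfl

lemma H1π_mem_range_H1map (i : A ⟶ M) (hi : Function.Injective i.hom) (f : cocycles₁ M) (x : M)
    (h : ∀ g, ∃ a, i.hom a = f g - (M.ρ g x - x)) : H1π M f ∈ (H1map i).range := by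
  choose a ha using h
  have hcoc : a ∈ cocycles₁ A := by
    rw [mem_cocycles₁_iff]
    intro g h
    apply hi
    rw [map_add, Rep.hom_comm_apply, ha, ha, ha, cocycles₁_map_mul]
    simp only [map_mul, Module.End.mul_apply, map_sub]
    abel
  refine ⟨H1π A ⟨a, hcoc⟩, ?_⟩
  rw [H1map_H1π, H1π_eq_iff]
  refine ⟨-x, funext fun g ↦ ?_⟩
  change M.ρ g (-x) - (-x) = i.hom (a g) - f g
  rw [ha, map_neg]
  abel

lemma ker_H1map_le_range (i : A ⟶ M) (q : M ⟶ B) (hi : Function.Injective i.hom)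
    (hq : Function.Surjective q.hom) (hqi : ∀ x, q.hom x = 0 → ∃ a, i.hom a = x) :
    (H1map q).ker ≤ (H1map i).range := by
  intro y hy
  obtain ⟨f, rfl⟩ := exists_H1π_eq y
  rw [AddMonoidHom.mem_ker, H1map_H1π, H1π_eq_zero_iff_exists] at hy
  obtain ⟨b, hb⟩ := hy
  obtain ⟨x, rfl⟩ := hq b
  refine H1π_mem_range_H1map i hi f x fun g ↦ ?_
  apply hqi
  have := hb g
  rw [mapCocycles₁_id_apply] at this
  rw [map_sub, map_sub, Rep.hom_comm_apply, this, sub_self]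

lemma finite_and_card_torsionBy_H1_le (p : ℕ) (i : A ⟶ M) (q : M ⟶ B)
    (hi : Function.Injective i.hom) (hq : Function.Surjective q.hom)
    (hqi : ∀ x, q.hom x = 0 → ∃ a, i.hom a = x)
    [Finite (groupCohomology A 1)] [Finite (groupCohomology B 1)] :
    Finite (groupCohomology M 1) ∧
      Nat.card (AddSubgroup.torsionBy (groupCohomology M 1) (p : ℤ)) ≤
        Nat.card (AddSubgroup.torsionBy (groupCohomology A 1) (p : ℤ)) *
          Nat.card (AddSubgroup.torsionBy (groupCohomology B 1) (p : ℤ)) :=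
  (H1map i).finite_and_card_torsionBy_le_of_exact p _ (ker_H1map_le_range i q hi hq hqi)

instance finite_H1 [Finite G] [Finite M] : Finite (groupCohomology M 1) :=
  have : Finite (cocycles₁ M) := Finite.of_injective (fun f ↦ (f : G → M)) Subtype.val_injective
  Finite.of_surjective (H1π M) exists_H1π_eq

lemma card_nsmul_H1_eq_zero [Finite G] (y : groupCohomology M 1) : Nat.card G • y = 0 := by
  have := Fintype.ofFinite G
  obtain ⟨f, rfl⟩ := exists_H1π_eq y
  rw [← map_nsmul, H1π_eq_zero_iff_exists]
  refine ⟨-∑ h, f h, fun g ↦ ?_⟩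
  have h1 : ∑ h, f (g * h) = ∑ h, f h := Equiv.sum_comp (Equiv.mulLeft g) f
  simp only [cocycles₁_map_mul, Finset.sum_add_distrib, Finset.sum_const,
    ← map_sum, Finset.card_univ, ← Nat.card_eq_fintype_card] at h1
  rw [map_neg, neg_sub_neg]
  exact eq_sub_of_add_eq' h1

/-- If `p` acts surjectively on `M`, then `H¹(G, M[p]) → H¹(G, M)[p]` is surjective. -/
lemma torsionBy_H1_le_range (p : ℕ) (i : A ⟶ M) (hi : Function.Injective i.hom)
    (hp : ∀ x : M, ∃ y : M, p • y = x) (hpi : ∀ x : M, p • x = 0 → ∃ a, i.hom a = x) :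
    AddSubgroup.torsionBy (groupCohomology M 1) (p : ℤ) ≤ (H1map i).range := by
  intro y hy
  rw [AddSubgroup.mem_torsionBy_natCast] at hy
  obtain ⟨f, rfl⟩ := exists_H1π_eq y
  rw [← map_nsmul, H1π_eq_zero_iff_exists] at hy
  obtain ⟨b, hb⟩ := hy
  obtain ⟨x, rfl⟩ := hp b
  refine H1π_mem_range_H1map i hi f x fun g ↦ ?_
  apply hpi
  have : p • f g = M.ρ g (p • x) - p • x := hb g
  rw [smul_sub, smul_sub, this, map_nsmul, sub_self]

lemma exists_fixed_of_card_eq_pow {p : ℕ} [Fact p.Prime] (hG : IsPGroup p G) {n : ℕ}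
    (hM : Nat.card M = p ^ (n + 1)) : ∃ x : M, x ≠ 0 ∧ p • x = 0 ∧ ∀ g, M.ρ g x = x := by
  have : Finite M := Nat.finite_of_card_ne_zero (by simp [hM, NeZero.ne p])
  let : MulAction G M :=
    { smul := fun g x ↦ M.ρ g x
      one_smul := fun x ↦ by change M.ρ 1 x = x; simp
      mul_smul := fun g h x ↦ by change M.ρ (g * h) x = M.ρ g (M.ρ h x); simp }
  have h0 : (0 : M) ∈ MulAction.fixedPoints G M := fun g ↦ map_zero (M.ρ g)
  obtain ⟨b, hb, hb0⟩ := hG.exists_fixed_point_of_prime_dvd_card_of_fixed_point M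
    (hM ▸ dvd_pow_self p n.succ_ne_zero) h0
  have hk : ∃ k, p ^ k • b = 0 := ⟨n + 1, hM ▸ card_nsmul_eq_zero'⟩
  classical
  have hk0 : Nat.find hk ≠ 0 := fun h ↦ hb0 (by simpa [h] using (Nat.find_spec hk).symm)
  obtain ⟨m, hm⟩ := Nat.exists_eq_succ_of_ne_zero hk0
  refine ⟨p ^ m • b, Nat.find_min hk (by omega), ?_, fun g ↦ ?_⟩
  · rw [← mul_smul, ← pow_succ', ← Nat.succ_eq_add_one, ← hm]
    exact Nat.find_spec hk
  · rw [map_nsmul]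
    exact congrArg (p ^ m • ·) (hb g)

/-- The morphism from the trivial representation `ℤ/p` given by a fixed point killed by `p`. -/
noncomputable def ofFixedPoint (p : ℕ) (x : M) (hx : p • x = 0) (hfix : ∀ g, M.ρ g x = x) :
    Rep.trivial ℤ G (ZMod p) ⟶ M :=
  let f : ZMod p →+ M := ZMod.lift p ⟨(zmultiplesHom M) x, by simpa using hx⟩
  Rep.ofHom (σ := M.ρ) 
    ⟨{ toFun := f
       map_add' := map_add f
       map_smul' := fun n z ↦ by simpa using map_intCast_smul f ℤ ℤ n z }, fun g ↦ by
      refine LinearMap.ext fun z ↦ ?_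
      obtain ⟨z, rfl⟩ := ZMod.intCast_surjective z
      change f z = M.ρ g (f z)
      simp [f, hfix]⟩

lemma ofFixedPoint_injective (p : ℕ) [Fact p.Prime] (x : M) (hx : p • x = 0)
    (hfix : ∀ g, M.ρ g x = x) (hx0 : x ≠ 0) :
    Function.Injective (ofFixedPoint p x hx hfix).hom := by
  refine (ZMod.lift_injective p (f := ⟨zmultiplesHom M x, by simpa using hx⟩)).2 fun m hm ↦ ?_
  replace hm : m • x = 0 := hm
  rw [ZMod.intCast_zmod_eq_zero_iff_dvd, ← addOrderOf_eq_prime hx hx0]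
  exact addOrderOf_dvd_iff_zsmul_eq_zero.2 hm

lemma card_torsionBy_H1_le_pow {p : ℕ} [Fact p.Prime] [Finite G] (hG : IsPGroup p G) (n : ℕ)
    (M : Rep ℤ G) (hM : Nat.card M = p ^ n) :
    Nat.card (AddSubgroup.torsionBy (groupCohomology M 1) (p : ℤ)) ≤
      Nat.card (AddSubgroup.torsionBy
        (groupCohomology (Rep.trivial ℤ G (ZMod p)) 1) (p : ℤ)) ^ n := by
  have hfin : Finite M := Nat.finite_of_card_ne_zero (by simp [hM, NeZero.ne p])
  induction n generalizing M with
  | zero =>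
    have : Subsingleton M := (Nat.card_eq_one_iff_unique.1 (by simpa using hM)).1
    have : Subsingleton (cocycles₁ M) := Subtype.val_injective.subsingleton
    have : Subsingleton (groupCohomology M 1) :=
      Function.Surjective.subsingleton (f := H1π M) exists_H1π_eq
    exact Finite.card_le_one_iff_subsingleton.2 inferInstance
  | succ n ih =>
    obtain ⟨x, hx0, hx, hfix⟩ := exists_fixed_of_card_eq_pow hG hM
    let i := ofFixedPoint p x hx hfix
    have hi : Function.Injective i.hom := ofFixedPoint_injective p x hx hfix hx0
    let W := LinearMap.range i.hom.toLinearMap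
    have hW (g : G) : W ≤ W.comap (M.ρ g) := by
      rintro _ ⟨a, rfl⟩
      exact ⟨a, Rep.hom_comm_apply i g a⟩
    have hcard : Nat.card (M.quotient W hW) = p ^ n := by
      have h := W.card_eq_card_quotient_mul_card
      have hWp : Nat.card W = p :=
        (Nat.card_congr (Equiv.ofInjective _ hi)).symm.trans (Nat.card_zmod p)
      rw [hM, hWp, pow_succ'] at h
      exact Nat.eq_of_mul_eq_mul_left (Fact.out (p := p.Prime)).pos h.symm
    have hq : Finite (M.quotient W hW) := Finite.of_surjective _ W.mkQ_surjective
    have hz : Finite (Rep.trivial ℤ G (ZMod p)) := inferInstanceAs (Finite (ZMod p))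
    rw [pow_succ']
    exact (finite_and_card_torsionBy_H1_le p i (M.mkQ W hW) hi W.mkQ_surjective
      fun y hy ↦ (Submodule.Quotient.mk_eq_zero W).1 hy).2.trans
        (Nat.mul_le_mul_left _ (ih _ hcard hq))

lemma finite_H1_of_finite_torsionBy [Finite G] {p : ℕ} (hG : IsPGroup p G) [Fact p.Prime]
    (h : Finite (AddSubgroup.torsionBy (groupCohomology M 1) (p : ℤ))) :
    Finite (groupCohomology M 1) := by
  obtain ⟨k, hk⟩ := hG.exists_card_eq
  have := AddSubgroup.finite_torsionBy_pow p h k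
  exact Finite.of_injective (β := AddSubgroup.torsionBy (groupCohomology M 1) ((p ^ k : ℕ) : ℤ))
    (fun y ↦ ⟨y, AddSubgroup.mem_torsionBy_natCast.2 (hk ▸ card_nsmul_H1_eq_zero y)⟩)
    fun _ _ h ↦ congrArg Subtype.val h

lemma finite_and_card_torsionBy_H1_le_of_divisible [Finite G] {p : ℕ} (hG : IsPGroup p G)
    [Fact p.Prime] (hp : ∀ x : M, ∃ y : M, p • y = x) (r : ℕ)
    (hr : Nat.card {x : M // p • x = 0} = p ^ r) :
    Finite (groupCohomology M 1) ∧
      Nat.card (AddSubgroup.torsionBy (groupCohomology M 1) (p : ℤ)) ≤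
        Nat.card (AddSubgroup.torsionBy
          (groupCohomology (Rep.trivial ℤ G (ZMod p)) 1) (p : ℤ)) ^ r := by
  let T := AddSubgroup.toSubmoduleInt (AddSubgroup.torsionBy M (p : ℤ))
  have hT (x : M) : x ∈ T ↔ p • x = 0 := AddSubgroup.mem_torsionBy_natCast
  have hTG (g : G) : T ≤ T.comap (M.ρ g) := fun x hx ↦ by
    rw [Submodule.mem_comap, hT, ← map_nsmul, (hT x).1 hx, map_zero]
  let A := M.subrepresentation T hTG
  have hA : Nat.card A = p ^ r := by
    rw [← hr]
    exact Nat.card_congr (Equiv.subtypeEquivRight hT)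
  have : Finite A := Nat.finite_of_card_ne_zero (by simp [hA, NeZero.ne p])
  let i : A ⟶ M := M.subtype T hTG
  have hle := torsionBy_H1_le_range p i Subtype.val_injective hp
    fun x hx ↦ ⟨⟨x, (hT x).2 hx⟩, rfl⟩
  have hker (y : groupCohomology A 1) : p • y = 0 := by
    obtain ⟨f, rfl⟩ := exists_H1π_eq y
    have : p • f = 0 := cocycles₁_ext fun g ↦ Subtype.ext ((hT _).1 (f g).2)
    rw [← map_nsmul, this, map_zero]
  have hr : Finite (H1map i).range := Finite.of_surjective _ (H1map i).rangeRestrict_surjective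
  have hinj := AddSubgroup.inclusion_injective hle
  have hfin : Finite (AddSubgroup.torsionBy (groupCohomology M 1) (p : ℤ)) :=
    Finite.of_injective _ hinj
  refine ⟨finite_H1_of_finite_torsionBy hG hfin, ?_⟩
  calc _ ≤ Nat.card (H1map i).range := Nat.card_le_card_of_injective _ hinj
    _ ≤ Nat.card (groupCohomology A 1) :=
      Nat.card_le_card_of_surjective _ (H1map i).rangeRestrict_surjective
    _ = Nat.card (AddSubgroup.torsionBy (groupCohomology A 1) (p : ℤ)) :=
      (Nat.card_congr (Equiv.subtypeUnivEquiv
        fun y ↦ AddSubgroup.mem_torsionBy_natCast.2 (hker y))).symm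
    _ ≤ _ := card_torsionBy_H1_le_pow hG r A hA

theorem finite_and_card_torsionBy_H1_le_pow [Finite G] {p : ℕ} [Fact p.Prime]
    (hG : IsPGroup p G) (M : Rep ℤ G) (D : AddSubgroup M)
    (hDinv : ∀ (g : G), ∀ x ∈ D, M.ρ g x ∈ D) (hDdiv : ∀ x ∈ D, ∃ y ∈ D, p • y = x)
    (r t : ℕ) (hDp : Nat.card {x : M // x ∈ D ∧ p • x = 0} = p ^ r)
    (hMD : Nat.card (M ⧸ D) = p ^ t) :
    Finite (groupCohomology M 1) ∧
      Nat.card (AddSubgroup.torsionBy (groupCohomology M 1) (p : ℤ)) ≤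
        Nat.card (AddSubgroup.torsionBy
          (groupCohomology (Rep.trivial ℤ G (ZMod p)) 1) (p : ℤ)) ^ (r + t) := by
  let D' := D.toSubmoduleInt
  have hD (g : G) : D' ≤ D'.comap (M.ρ g) := fun x hx ↦ hDinv g x hx
  obtain ⟨hA, hAcard⟩ := finite_and_card_torsionBy_H1_le_of_divisible
    (M := M.subrepresentation D' hD) hG
    (fun x ↦ by
      obtain ⟨y, hy, hyx⟩ := hDdiv x x.2
      exact ⟨⟨y, hy⟩, Subtype.ext hyx⟩) r (by
      rw [← hDp]
      exact Nat.card_congr ((Equiv.subtypeEquivRight fun _ ↦ Subtype.ext_iff).trans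
        (Equiv.subtypeSubtypeEquivSubtypeInter (· ∈ D) (p • · = 0))))
  have hBcard := card_torsionBy_H1_le_pow hG t (M.quotient D' hD) hMD
  have : Finite (M.quotient D' hD) :=
    Nat.finite_of_card_ne_zero (hMD.trans_ne (pow_ne_zero t (NeZero.ne p)))
  have : Finite (Rep.trivial ℤ G (ZMod p)) := inferInstanceAs (Finite (ZMod p))
  have h := finite_and_card_torsionBy_H1_le p (M.subtype D' hD) (M.mkQ D' hD)
    Subtype.val_injective D'.mkQ_surjective
    fun x hx ↦ ⟨⟨x, (Submodule.Quotient.mk_eq_zero D').1 hx⟩, rfl⟩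
  refine ⟨h.1, h.2.trans ?_⟩
  rw [pow_add]
  exact Nat.mul_le_mul hAcard hBcard

end groupCohomology

theorem rank_bound_on_H1
    (p : ℕ) (hp : p.Prime) (G : Type) [Group G] [Finite G] (hG : IsPGroup p G)
    (M : Rep ℤ G) (hMtors : ∀ x : M, ∃ k : ℕ, p ^ k • x = 0)
    (D : Submodule ℤ M.V)
    (hDinv : ∀ (g : G), ∀ x ∈ D, M.ρ g x ∈ D)
    (hDdiv : ∀ x ∈ D, ∃ y ∈ D, p • y = x)
    (r t : ℕ)
    (hDp : Nat.card {x : M // x ∈ D ∧ p • x = 0} = p ^ r)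
    (hMD : Nat.card (M.V ⧸ D) = p ^ t) :
    Finite (AddSubgroup.torsionBy (groupCohomology M 1) p) ∧
      rp p (groupCohomology M 1) ≤
        rp p (groupCohomology (Rep.trivial ℤ G (ZMod p)) 1) * (r + t) := by
  have := Fact.mk hp
  have : Finite (Rep.trivial ℤ G (ZMod p)) := inferInstanceAs (Finite (ZMod p))
  obtain ⟨hM, hcard⟩ := finite_and_card_torsionBy_H1_le_pow hG M D.toAddSubgroup hDinv hDdiv
    r t hDp hMD
  refine ⟨inferInstance, (Nat.pow_le_pow_iff_right hp.one_lt).1 ?_⟩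
  rwa [pow_mul, ← card_torsionBy_eq_pow_rp, ← card_torsionBy_eq_pow_rp]
end

section
/- Let p be a prime, G a finite p-group, and set h₂(G) := r_p(H^2(G, 𝔽_p)) where 𝔽_p = ℤ/pℤ carries the trivial G-action. Let M be a G-module that is a p-primary torsion abelian group, and suppose D is a G-submodule of M such that multiplication by p is surjective on D, D[p] is finite of order p^r, and M/D is finite of order p^t. Then H^2(G, M)[p] is finite and r_p(H^2(G, M)) ≤ h₂(G)·(r + t). -/
/-!
STATEMENT 10: Let p be a prime, G a finite p-group, and set h₂(G) := r_p(H^2(G, 𝔽_p))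
where 𝔽_p = ℤ/pℤ carries the trivial G-action.  Let M be a G-module that is a p-primary
torsion abelian group, and suppose D is a G-submodule of M such that multiplication by p
is surjective on D, D[p] is finite of order p^r, and M/D is finite of order p^t.
Then H^2(G, M)[p] is finite and r_p(H^2(G, M)) ≤ h₂(G)·(r + t).
-/

open groupCohomology

section

open CategoryTheory

theorem AddMonoidHom.natCard_eq_ker_mul_range {A B : Type*} [AddGroup A] [AddGroup B]
    (f : A →+ B) : Nat.card A = Nat.card f.ker * Nat.card f.range := by
  rw [← AddSubgroup.index_ker, AddSubgroup.card_mul_index]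

theorem AddSubgroup.natCard_torsionBy_eq_index {A : Type*} [AddCommGroup A] [Finite A] (n : ℤ) :
    Nat.card (torsionBy A n) = (zsmulAddGroupHom n : A →+ A).range.index := by
  rw [AddSubgroup.index_range]
  rfl

theorem AddSubgroup.natCard_torsionBy_le_of_surjective {A B : Type*} [AddCommGroup A]
    [AddCommGroup B] [Finite A] (f : A →+ B) (hf : Function.Surjective f) (n : ℤ) :
    Nat.card (torsionBy B n) ≤ Nat.card (torsionBy A n) := by
  have : Finite B := Finite.of_surjective f hf
  have hmap : (zsmulAddGroupHom n : B →+ B).range = (zsmulAddGroupHom n : A →+ A).range.map f := by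
    ext b
    simp only [AddMonoidHom.mem_range, mem_map, zsmulAddGroupHom_apply]
    constructor
    · rintro ⟨c, rfl⟩
      obtain ⟨a, rfl⟩ := hf c
      exact ⟨_, ⟨a, rfl⟩, map_zsmul f n a⟩
    · rintro ⟨_, ⟨a, rfl⟩, rfl⟩
      exact ⟨f a, (map_zsmul f n a).symm⟩
  rw [natCard_torsionBy_eq_index, natCard_torsionBy_eq_index, hmap]
  exact Nat.le_of_dvd (Nat.pos_of_ne_zero AddSubgroup.FiniteIndex.index_ne_zero)
    (AddSubgroup.index_map_dvd _ hf)

section Exact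

variable {A B C : Type*} [AddCommGroup A] [AddCommGroup B] [AddCommGroup C]
  {f : A →+ B} {g : B →+ C}

theorem Function.Exact.natCard_le [Finite A] [Finite C] (h : Function.Exact f g) :
    Nat.card B ≤ Nat.card A * Nat.card C := by
  rw [g.natCard_eq_ker_mul_range, h.addMonoidHom_ker_eq]
  exact Nat.mul_le_mul (Nat.card_le_card_of_surjective _ f.rangeRestrict_surjective)
    (Nat.card_le_card_of_injective _ Subtype.val_injective)

theorem Function.Exact.finite [Finite A] [Finite C] (h : Function.Exact f g) : Finite B := by
  apply Nat.finite_of_card_ne_zero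
  rw [g.natCard_eq_ker_mul_range, h.addMonoidHom_ker_eq]
  have : Finite f.range := Finite.of_surjective _ f.rangeRestrict_surjective
  exact mul_ne_zero Nat.card_pos.ne' Nat.card_pos.ne'

theorem Function.Exact.natCard_torsionBy_le [Finite A] [Finite C] (h : Function.Exact f g)
    (n : ℤ) :
    Nat.card (AddSubgroup.torsionBy B n) ≤
      Nat.card (AddSubgroup.torsionBy A n) * Nat.card C := by
  have : Finite f.range := Finite.of_surjective _ f.rangeRestrict_surjective
  let φ := g.comp (AddSubgroup.torsionBy B n).subtype
  have hmem (x : φ.ker) : (x : AddSubgroup.torsionBy B n).1 ∈ f.range := (h x.1.1).1 x.2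
  rw [φ.natCard_eq_ker_mul_range]
  refine Nat.mul_le_mul (le_trans ?_ (AddSubgroup.natCard_torsionBy_le_of_surjective _
    f.rangeRestrict_surjective n)) (Nat.card_le_card_of_injective _ Subtype.val_injective)
  refine Nat.card_le_card_of_injective
    (fun x : φ.ker ↦ (⟨⟨x.1.1, hmem x⟩, Subtype.ext x.1.2⟩ : AddSubgroup.torsionBy f.range n)) ?_
  intro x y hxy
  exact Subtype.ext (Subtype.ext (congrArg (fun z ↦ z.1.1) hxy))

end Exact

theorem finite_of_pow_smul_eq_zero {A : Type*} [AddCommGroup A] (p m : ℕ)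
    [Finite (AddSubgroup.torsionBy A p)] (h : ∀ x : A, p ^ m • x = 0) : Finite A := by
  have key (k : ℕ) : {x : A | p ^ k • x = 0}.Finite := by
    induction k with
    | zero => simp
    | succ k ih =>
      have : {x : A | p ^ (k + 1) • x = 0} = (fun x ↦ p • x) ⁻¹' {x : A | p ^ k • x = 0} := by
        ext x
        simp [pow_succ, mul_smul]
      rw [this]
      refine ih.preimage' fun b _ ↦ ?_
      rcases Set.eq_empty_or_nonempty ((fun x : A ↦ p • x) ⁻¹' {b}) with he | ⟨a, ha⟩
      · simp [he]
      · refine ((Set.toFinite (AddSubgroup.torsionBy A p : Set A)).image (a + ·)).subset ?_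
        intro x hx
        refine ⟨x - a, ?_, by simp⟩
        simp only [Set.mem_preimage, Set.mem_singleton_iff] at ha hx
        change (p : ℤ) • (x - a) = 0
        rw [natCast_zsmul, smul_sub, hx, ha, sub_self]
  exact Set.finite_univ_iff.1 ((key m).subset fun x _ ↦ h x)

namespace Rep

section ShortExact

variable {k G : Type} [CommRing k] [Group G] {A B C : Rep.{0} k G}

/-- The additive map on cohomology induced by a morphism of representations. -/
noncomputable def cohomologyMap (f : A ⟶ B) (n : ℕ) :
    groupCohomology A n →+ groupCohomology B n :=
  ((functor k G n).map f).hom.toAddMonoidHom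

theorem exact_cohomologyMap (f : A ⟶ B) (g : B ⟶ C) (hf : Function.Injective f.hom)
    (h : Function.Exact f.hom g.hom) (hg : Function.Surjective g.hom) (n : ℕ) :
    Function.Exact (cohomologyMap f n) (cohomologyMap g n) := by
  let S : ShortComplex (Rep k G) := ⟨f, g, by
    ext x
    exact h.apply_apply_eq_zero x⟩
  have hS : S.ShortExact := {
    exact := (S.exact_map_iff_of_faithful (forget₂ (Rep k G) (ModuleCat k))).1
      ((ShortComplex.ShortExact.moduleCat_exact_iff_function_exact _).2 h)
    mono_f := (mono_iff_injective _).2 hf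
    epi_g := (epi_iff_surjective _).2 hg }
  exact (ShortComplex.ShortExact.moduleCat_exact_iff_function_exact _).1
    (mapShortComplex₂_exact hS n)

theorem cohomologyMap_nsmul_id (A : Rep.{0} k G) (n : ℕ) (x : groupCohomology A 2) :
    cohomologyMap (n • 𝟙 A) 2 x = n • x := by
  induction x using H2_induction_on with
  | h x =>
    change (H2π A ≫ groupCohomology.map (MonoidHom.id G) (n • 𝟙 A) 2) x = _
    rw [H2π_comp_map, ← map_nsmul]
    rfl

/-- The range of a morphism of representations, as an additive subgroup. -/
def addRange (f : A ⟶ B) : AddSubgroup B.V := f.hom.toLinearMap.toAddMonoidHom.range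

theorem exists_cokernel (f : A ⟶ B) :
    ∃ (Q : Rep.{0} k G) (g : B ⟶ Q), Function.Surjective g.hom ∧ Function.Exact f.hom g.hom ∧
      Nat.card Q = (addRange f).index := by
  have hW (g : G) : f.hom.toLinearMap.range ≤ f.hom.toLinearMap.range.comap (B.ρ g) := by
    rintro _ ⟨x, rfl⟩
    exact ⟨_, hom_comm_apply f g x⟩
  exact ⟨B.quotient _ hW, B.mkQ _ hW, Submodule.mkQ_surjective _,
    LinearMap.exact_map_mkQ_range f.hom.toLinearMap, rfl⟩

theorem exists_subrepresentation (A : Rep.{0} k G) (D : AddSubgroup A.V)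
    (hsmul : ∀ (c : k), ∀ x ∈ D, c • x ∈ D) (hD : ∀ (g : G), ∀ x ∈ D, A.ρ g x ∈ D) :
    ∃ (B : Rep.{0} k G) (f : B ⟶ A), Function.Injective f.hom ∧ addRange f = D := by
  let W : Submodule k A.V := { D with smul_mem' := fun c x hx ↦ hsmul c x hx }
  exact ⟨A.subrepresentation W hD, A.subtype W hD, W.injective_subtype, D.range_subtype⟩

theorem exists_hom_of_addMonoidHom (φ : A.V →+ B.V) (hsmul : ∀ (c : k) x, φ (c • x) = c • φ x)
    (hφ : ∀ g x, φ (A.ρ g x) = B.ρ g (φ x)) : ∃ f : A ⟶ B, ∀ x, f.hom x = φ x :=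
  ⟨ofHom ⟨{ φ with map_smul' := hsmul }, fun g ↦ LinearMap.ext (hφ g)⟩, fun _ ↦ rfl⟩

theorem torsionBy_le_comap (A : Rep.{0} k G) (a : k) (g : G) :
    Submodule.torsionBy k A.V a ≤ (Submodule.torsionBy k A.V a).comap (A.ρ g) := by
  intro x hx
  simp only [Submodule.mem_comap, Submodule.mem_torsionBy_iff] at hx ⊢
  rw [← map_smul, hx, map_zero]

/-- The `n`-torsion subrepresentation. -/
noncomputable abbrev torsion (A : Rep.{0} k G) (n : ℕ) : Rep k G :=
  A.subrepresentation _ (A.torsionBy_le_comap (n : k))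

theorem natCard_torsion (A : Rep.{0} k G) (n : ℕ) :
    Nat.card (A.torsion n) = Nat.card {x : A.V // n • x = 0} :=
  Nat.card_congr (Equiv.subtypeEquivRight fun x ↦ by
    rw [Submodule.mem_torsionBy_iff, Nat.cast_smul_eq_nsmul])

theorem exact_cohomologyMap_torsion (A : Rep.{0} k G) (n : ℕ) (hn : ∀ x : A.V, ∃ y, n • y = x)
    (i : ℕ) :
    Function.Exact
      (cohomologyMap (A.subtype _ (A.torsionBy_le_comap (n : k))) i)
      (cohomologyMap (n • 𝟙 A) i) := by
  refine exact_cohomologyMap _ (n • 𝟙 A) (Submodule.injective_subtype _) ?_ hn i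
  intro x
  have h : n • x = 0 ↔ x ∈ Submodule.torsionBy k A.V (n : k) := by
    rw [Submodule.mem_torsionBy_iff, Nat.cast_smul_eq_nsmul]
  exact h.trans ⟨fun h ↦ ⟨⟨x, h⟩, rfl⟩, by rintro ⟨y, rfl⟩; exact y.2⟩

/-- If `n` acts surjectively on `A`, then `H²(G, A)[n]` is a quotient of `H²(G, A[n])`; choosing
preimages gives an injective map in the other direction. -/
theorem exists_injective_torsionBy (A : Rep.{0} k G) (n : ℕ) (hn : ∀ x : A.V, ∃ y, n • y = x) :
    ∃ s : AddSubgroup.torsionBy (groupCohomology A 2) n → groupCohomology (A.torsion n) 2,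
      Function.Injective s := by
  have hsurj (x : AddSubgroup.torsionBy (groupCohomology A 2) n) :
      ∃ y, cohomologyMap (A.subtype _ (A.torsionBy_le_comap (n : k))) 2 y = x.1 := by
    refine (A.exact_cohomologyMap_torsion n hn 2 x.1).1 ((A.cohomologyMap_nsmul_id n x.1).trans ?_)
    rw [← natCast_zsmul]
    exact x.2
  choose s hs using hsurj
  exact ⟨s, fun x y h ↦ Subtype.ext (by rw [← hs, ← hs, h])⟩

end ShortExact

end Rep

namespace groupCohomology

variable {k G : Type} [CommRing k] [Group G]

theorem H2π_surjective (A : Rep.{0} k G) : Function.Surjective (H2π A) :=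
  (ModuleCat.epi_iff_surjective _).1 inferInstance

instance [Finite G] (A : Rep.{0} k G) [Finite A.V] : Finite (groupCohomology A 2) :=
  have : Finite (cocycles₂ A) := Subtype.finite
  Finite.of_surjective _ (H2π_surjective A)

theorem smul_eq_zero_of_forall_smul_eq_zero (A : Rep.{0} k G) (n : ℕ) (h : ∀ x : A.V, n • x = 0)
    (x : groupCohomology A 2) : n • x = 0 := by
  obtain ⟨x, rfl⟩ := H2π_surjective A x
  rw [← map_nsmul]
  have : n • x = 0 := Subtype.ext (funext fun y ↦ h (x y))
  rw [this, map_zero]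

theorem natCard_smul_eq_zero [Finite G] (A : Rep.{0} k G) (x : groupCohomology A 2) :
    Nat.card G • x = 0 := by
  have := Fintype.ofFinite G
  obtain ⟨x, rfl⟩ := H2π_surjective A x
  rw [← map_nsmul, H2π_eq_zero_iff]
  refine ⟨fun g ↦ ∑ h, x (g, h), funext fun ⟨g, h⟩ ↦ ?_⟩
  have key := Finset.sum_congr rfl fun j (_ : j ∈ Finset.univ) ↦ (mem_cocycles₂_iff x.1).1 x.2 g h j
  have hshift := Equiv.sum_comp (Equiv.mulLeft h) fun j ↦ x (g, j)
  simp only [Finset.sum_add_distrib, Finset.sum_const, Finset.card_univ, Equiv.coe_mulLeft]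
    at key hshift
  change A.ρ g (∑ j, x (h, j)) - ∑ j, x (g * h, j) + ∑ j, x (g, j) = Nat.card G • x (g, h)
  rw [map_sum, Nat.card_eq_fintype_card, ← hshift]
  erw [sub_add_eq_add_sub, sub_eq_iff_eq_add', ← key]
  rfl

end groupCohomology

theorem Rep.exists_injective_trivial_zmod {p : ℕ} [Fact p.Prime] {G : Type} [Group G]
    (hG : IsPGroup p G) (A : Rep.{0} ℤ G) [Finite A.V] (hA : p ∣ Nat.card A.V) :
    ∃ f : Rep.trivial ℤ G (ZMod p) ⟶ A, Function.Injective f.hom := by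
  let : MulAction G A.V :=
    { smul g x := A.ρ g x
      one_smul x := by change A.ρ 1 x = x; simp
      mul_smul g h x := by change A.ρ (g * h) x = A.ρ g (A.ρ h x); simp }
  let F : AddSubgroup A.V :=
    { carrier := {x | ∀ g, A.ρ g x = x}
      zero_mem' g := map_zero _
      add_mem' hx hy g := by rw [map_add, hx g, hy g]
      neg_mem' hx g := by rw [map_neg, hx g] }
  have hcard : p ∣ Nat.card F :=
    ((hG.card_modEq_card_fixedPoints A.V).dvd_iff dvd_rfl).1 hA
  obtain ⟨x, hx⟩ := exists_prime_addOrderOf_dvd_card' p hcard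
  let φ : ZMod p →+ F := ZMod.lift p ⟨zmultiplesHom _ x, by
    simp [← hx, addOrderOf_nsmul_eq_zero]⟩
  have hφ : Function.Injective φ := by
    refine (ZMod.lift_injective _).2 fun m hm ↦ ?_
    rw [ZMod.intCast_zmod_eq_zero_iff_dvd, ← hx]
    exact addOrderOf_dvd_iff_zsmul_eq_zero.2 hm
  obtain ⟨f, hf⟩ := exists_hom_of_addMonoidHom (A := Rep.trivial ℤ G (ZMod p)) (B := A)
    (F.subtype.comp φ)
    (fun c y ↦ (map_zsmul (F.subtype.comp φ) c y).trans (int_smul_eq_zsmul A.hV2 c _).symm)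
    (fun g y ↦ ((φ y).2 g).symm)
  refine ⟨f, fun y z hyz ↦ hφ (Subtype.ext ?_)⟩
  rw [hf, hf] at hyz
  exact hyz

theorem groupCohomology.natCard_H2_le {p : ℕ} [Fact p.Prime] {G : Type} [Group G] [Finite G]
    (hG : IsPGroup p G) (n : ℕ) (A : Rep.{0} ℤ G) (hA : Nat.card A.V = p ^ n) :
    Nat.card (groupCohomology A 2) ≤
      Nat.card (groupCohomology (Rep.trivial ℤ G (ZMod p)) 2) ^ n := by
  induction n generalizing A with
  | zero =>
    have : Subsingleton A.V := (Nat.card_eq_one_iff_unique.1 (by simpa using hA)).1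
    have : Subsingleton (cocycles₂ A) := Subtype.val_injective.subsingleton
    have := (H2π_surjective A).subsingleton
    simp
  | succ n ih =>
    have hp : p.Prime := Fact.out
    have : Finite A.V := Nat.finite_of_card_ne_zero (hA ▸ pow_ne_zero _ hp.ne_zero)
    obtain ⟨f, hf⟩ := Rep.exists_injective_trivial_zmod hG A (hA ▸ dvd_pow_self p n.succ_ne_zero)
    obtain ⟨Q, g, hg, hfg, hindex⟩ := Rep.exists_cokernel f
    have hQ : Nat.card Q = p ^ n := by
      have hcard := (Rep.addRange f).card_mul_index
      have hrange : Nat.card (Rep.addRange f) = p :=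
        (Nat.card_congr (Equiv.ofInjective _ hf)).symm.trans (Nat.card_zmod p)
      rw [hA, ← hindex, hrange, pow_succ'] at hcard
      exact Nat.eq_of_mul_eq_mul_left hp.pos hcard
    have : Finite Q := Finite.of_surjective _ hg
    have hexact := Rep.exact_cohomologyMap f g hf hfg hg 2
    calc
      _ ≤ _ := hexact.natCard_le
      _ ≤ _ := Nat.mul_le_mul_left _ (ih _ hQ)
      _ = _ := (pow_succ' _ _).symm

theorem rp_pow_eq_natCard (p : ℕ) [Fact p.Prime] (N : Type*) [AddCommGroup N]
    [Finite (AddSubgroup.torsionBy N p)] :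
    p ^ rp p N = Nat.card (AddSubgroup.torsionBy N p) := by
  let := AddSubgroup.torsionBy.zmodModule (A := N) (n := p)
  have : Module.Finite (ZMod p) (AddSubgroup.torsionBy N p) := Module.Finite.of_finite
  rw [Module.natCard_eq_pow_finrank (K := ZMod p), Nat.card_zmod]
  rfl

end

theorem rank_bound_on_H2
    (p : ℕ) (hp : p.Prime) (G : Type) [Group G] [Finite G] (hG : IsPGroup p G)
    (M : Rep ℤ G) (hMtors : ∀ x : M, ∃ k : ℕ, p ^ k • x = 0)
    (D : Submodule ℤ M.V)
    (hDinv : ∀ (g : G), ∀ x ∈ D, M.ρ g x ∈ D)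
    (hDdiv : ∀ x ∈ D, ∃ y ∈ D, p • y = x)
    (r t : ℕ)
    (hDp : Nat.card {x : M // x ∈ D ∧ p • x = 0} = p ^ r)
    (hMD : Nat.card (M.V ⧸ D) = p ^ t) :
    Finite (AddSubgroup.torsionBy (groupCohomology M 2) p) ∧
      rp p (groupCohomology M 2) ≤
        rp p (groupCohomology (Rep.trivial ℤ G (ZMod p)) 2) * (r + t) := by
  have : Fact p.Prime := ⟨hp⟩
  let q := Nat.card (groupCohomology (Rep.trivial ℤ G (ZMod p)) 2)
  have hq : q = p ^ rp p (groupCohomology (Rep.trivial ℤ G (ZMod p)) 2) := by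
    rw [rp_pow_eq_natCard]
    refine Nat.card_congr (Equiv.subtypeUnivEquiv fun x ↦ ?_).symm
    change (p : ℤ) • x = 0
    rw [natCast_zsmul]
    exact smul_eq_zero_of_forall_smul_eq_zero _ p (fun x : ZMod p ↦ by simp) x
  obtain ⟨B, f, hf, hrange⟩ := Rep.exists_subrepresentation M D.toAddSubgroup
    (fun c x hx ↦ (congrArg (· ∈ D.toAddSubgroup) (int_smul_eq_zsmul M.hV2 c x)).mpr
      (D.toAddSubgroup.zsmul_mem hx c)) hDinv
  obtain ⟨Q, g, hg, hfg, hindex⟩ := Rep.exists_cokernel f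
  have hmem (x : B.V) : f.hom x ∈ D := hrange.le ⟨x, rfl⟩
  have hlift (x : M.V) (hx : x ∈ D) : ∃ y, f.hom y = x := hrange.ge hx
  have hQ : Nat.card Q = p ^ t := by
    rw [hindex, hrange]
    exact hMD
  have : Finite Q := Nat.finite_of_card_ne_zero (hQ ▸ pow_ne_zero _ hp.ne_zero)
  have htors : Nat.card (B.torsion p) = p ^ r := by
    rw [← hDp, Rep.natCard_torsion]
    refine Nat.card_congr (Equiv.ofBijective
      (fun x ↦ ⟨f.hom x.1, hmem x.1, by rw [← map_nsmul, x.2, map_zero]⟩) ⟨?_, ?_⟩)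
    · intro x y hxy
      exact Subtype.ext (hf (congrArg Subtype.val hxy))
    · rintro ⟨x, hx, hpx⟩
      obtain ⟨y, rfl⟩ := hlift x hx
      exact ⟨⟨y, hf (by rw [map_nsmul, hpx, map_zero])⟩, rfl⟩
  have : Finite (B.torsion p) :=
    Nat.finite_of_card_ne_zero (htors ▸ pow_ne_zero _ hp.ne_zero)
  have hdiv (x : B.V) : ∃ y, p • y = x := by
    obtain ⟨y, hy, hyx⟩ := hDdiv _ (hmem x)
    obtain ⟨y, rfl⟩ := hlift y hy
    exact ⟨y, hf (by rw [map_nsmul, hyx])⟩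
  obtain ⟨s, hs⟩ := B.exists_injective_torsionBy p hdiv
  have : Finite (AddSubgroup.torsionBy (groupCohomology B 2) p) := Finite.of_injective s hs
  have hBcard : Nat.card (AddSubgroup.torsionBy (groupCohomology B 2) p) ≤ q ^ r :=
    (Nat.card_le_card_of_injective s hs).trans (natCard_H2_le hG r _ htors)
  obtain ⟨m, hm⟩ := IsPGroup.iff_card.1 hG
  have : Finite (groupCohomology B 2) :=
    finite_of_pow_smul_eq_zero p m fun x ↦ hm ▸ natCard_smul_eq_zero B x
  have hexact := Rep.exact_cohomologyMap f g hf hfg hg 2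
  have : Finite (groupCohomology M 2) := hexact.finite
  refine ⟨inferInstance, (Nat.pow_le_pow_iff_right hp.one_lt).1 ?_⟩
  rw [rp_pow_eq_natCard, pow_mul, ← hq, pow_add]
  exact (hexact.natCard_torsionBy_le p).trans
    (Nat.mul_le_mul hBcard (natCard_H2_le hG t _ hQ))
end

section
/- Let p be a prime, G a finite p-group, and set h₂(G) := r_p(H^2(G, 𝔽_p)) where 𝔽_p = ℤ/pℤ carries the trivial G-action. Let M be a G-module that is a p-primary torsion abelian group, and suppose D is a G-submodule of M such that multiplication by p is surjective on D, D[p] is finite of order p^r, and M/D is finite of order p^t. Then for every n ≥ 1, the subgroup H^2(G, M)[pⁿ] is finite of order at most p^{n·h₂(G)·(r+t)}, i.e., ord_p(H^2(G, M)[pⁿ]) ≤ n·h₂(G)·(r + t). -/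
/-!
STATEMENT 12: Let p be a prime, G a finite p-group, and set h₂(G) := r_p(H^2(G, 𝔽_p))
where 𝔽_p = ℤ/pℤ carries the trivial G-action.  Let M be a G-module that is a p-primary
torsion abelian group, and suppose D is a G-submodule of M such that multiplication by p
is surjective on D, D[p] is finite of order p^r, and M/D is finite of order p^t.
Then for every n ≥ 1, the subgroup H^2(G, M)[pⁿ] is finite of order at most
p^{n·h₁(G)·(r+t)}, i.e. ord_p(H^2(G, M)[pⁿ]) ≤ n·h₁(G)·(r + t).
-/

open groupCohomology

open CategoryTheory

namespace AddSubgroup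

theorem card_le_card_mul_card_of_map_le {A B : Type*} [AddCommGroup A] [AddCommGroup B]
    (f : A →+ B) {S K : AddSubgroup A} {T : AddSubgroup B} [Finite K] [Finite T]
    (hT : S.map f ≤ T) (hK : S ⊓ f.ker ≤ K) :
    Finite S ∧ Nat.card S ≤ Nat.card K * Nat.card T := by
  set φ := f.comp S.subtype
  have hker : Function.Injective fun x : φ.ker ↦ (⟨x.1.1, hK ⟨x.1.2, x.2⟩⟩ : K) :=
    fun x y h ↦ Subtype.ext (Subtype.ext (Subtype.mk.inj h))
  have hran : φ.range ≤ T := by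
    rintro _ ⟨x, rfl⟩
    exact hT ⟨x, x.2, rfl⟩
  have : Finite φ.ker := Finite.of_injective _ hker
  have : Finite φ.range := Finite.of_injective _ (inclusion_injective hran)
  refine ⟨φ.finite_iff_finite_ker_range.2 ⟨‹_›, ‹_›⟩, ?_⟩
  rw [← φ.ker.card_mul_index, index_ker]
  exact Nat.mul_le_mul (Nat.card_le_card_of_injective _ hker)
    (Nat.card_le_card_of_injective _ (inclusion_injective hran))

theorem card_torsionBy_eq_index_range_nsmul (A : Type*) [AddCommGroup A] [Finite A] (n : ℕ) :
    Nat.card (torsionBy A n) = (nsmulAddMonoidHom (α := A) n).range.index := by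
  rw [index_range]
  congr! 2
  ext x
  rw [torsionBy.nsmul_iff]
  rfl

theorem card_torsionBy_range_le {A B : Type*} [AddCommGroup A] [AddCommGroup B] [Finite A]
    (f : A →+ B) (n : ℕ) :
    Nat.card (torsionBy f.range n) ≤ Nat.card (torsionBy A n) := by
  have : Finite f.range := Finite.of_surjective _ f.rangeRestrict_surjective
  have hmap : (nsmulAddMonoidHom (α := f.range) n).range =
      (nsmulAddMonoidHom (α := A) n).range.map f.rangeRestrict := by
    ext x
    constructor
    · rintro ⟨y, rfl⟩
      obtain ⟨z, rfl⟩ := f.rangeRestrict_surjective y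
      exact ⟨n • z, ⟨z, rfl⟩, by simp⟩
    · rintro ⟨_, ⟨z, rfl⟩, rfl⟩
      exact ⟨f.rangeRestrict z, by simp⟩
  have hle : Nat.card (torsionBy f.range n) ≤ (nsmulAddMonoidHom (α := A) n).range.index := by
    rw [card_torsionBy_eq_index_range_nsmul, hmap]
    exact Nat.le_of_dvd (Nat.pos_of_ne_zero FiniteIndex.index_ne_zero)
      (index_map_dvd _ f.rangeRestrict_surjective)
  rwa [← card_torsionBy_eq_index_range_nsmul] at hle

theorem card_torsionBy_le_mul_of_exact {A B C : Type*} [AddCommGroup A] [AddCommGroup B]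
    [AddCommGroup C] [Finite A] [Finite C] (f : A →+ B) (g : B →+ C)
    (h : ∀ y, g y = 0 → ∃ x, f x = y) (n : ℕ) :
    Finite B ∧ Nat.card (torsionBy B n) ≤
      Nat.card (torsionBy A n) * Nat.card (torsionBy C n) := by
  have : Finite f.range := Finite.of_surjective _ f.rangeRestrict_surjective
  have hfin : Finite B := by
    have hker : Finite g.ker := Finite.of_injective
      (fun x : g.ker ↦ (⟨x.1, h x.1 x.2⟩ : f.range)) fun x y hxy ↦
        Subtype.ext (Subtype.mk.inj hxy)
    exact g.finite_iff_finite_ker_range.2 ⟨hker, inferInstance⟩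
  refine ⟨hfin, ?_⟩
  have hmap : (torsionBy B n).map g ≤ torsionBy C n := by
    rintro _ ⟨x, hx, rfl⟩
    rw [torsionBy.nsmul_iff, ← map_nsmul, torsionBy.nsmul_iff.1 hx, map_zero]
  have hker : torsionBy B n ⊓ g.ker ≤ (torsionBy f.range n).map f.range.subtype := by
    rintro x ⟨hx, hgx⟩
    exact ⟨⟨x, h x hgx⟩, torsionBy.nsmul_iff.2 (Subtype.ext (torsionBy.nsmul_iff.1 hx)), rfl⟩
  refine (card_le_card_mul_card_of_map_le g hmap hker).2.trans (Nat.mul_le_mul_right _ ?_)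
  rw [Nat.card_congr (equivMapOfInjective _ _ f.range.subtype_injective).symm.toEquiv]
  exact card_torsionBy_range_le f n

theorem card_torsionBy_pow_le (A : Type*) [AddCommGroup A] (m : ℕ) [Finite (torsionBy A (m : ℤ))]
    (n : ℕ) :
    Finite (torsionBy A ((m : ℤ) ^ n)) ∧
      Nat.card (torsionBy A ((m : ℤ) ^ n)) ≤ Nat.card (torsionBy A (m : ℤ)) ^ n := by
  induction n with
  | zero =>
    have : Subsingleton (torsionBy A ((m : ℤ) ^ 0)) :=
      ⟨fun x y ↦ Subtype.ext <| by
        have hx := x.2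
        have hy := y.2
        simp at hx hy
        rw [hx, hy]⟩
    exact ⟨inferInstance, by simp⟩
  | succ n ih =>
    have := ih.1
    have hmem (k : ℕ) (x : A) : x ∈ torsionBy A ((m : ℤ) ^ k) ↔ m ^ k • x = 0 := by
      rw [← Nat.cast_pow, torsionBy.nsmul_iff]
    have := card_le_card_mul_card_of_map_le (nsmulAddMonoidHom (α := A) m)
      (S := torsionBy A ((m : ℤ) ^ (n + 1))) (T := torsionBy A ((m : ℤ) ^ n))
      (K := torsionBy A (m : ℤ))
      (by
        rintro _ ⟨x, hx, rfl⟩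
        rw [SetLike.mem_coe, hmem] at hx
        rw [hmem]
        simpa [smul_smul, pow_succ] using hx)
      (fun x hx ↦ torsionBy.nsmul_iff.2 hx.2)
    refine ⟨this.1, this.2.trans ?_⟩
    rw [pow_succ']
    exact Nat.mul_le_mul_left _ ih.2

end AddSubgroup

theorem pow_rp (p : ℕ) [Fact p.Prime] (N : Type*) [AddCommGroup N]
    [Finite (AddSubgroup.torsionBy N (p : ℤ))] :
    p ^ rp p N = Nat.card (AddSubgroup.torsionBy N (p : ℤ)) := by
  let := AddSubgroup.torsionBy.zmodModule (A := N) (n := p)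
  rw [Module.natCard_eq_pow_finrank (K := ZMod p), Nat.card_zmod]
  rfl

universe u v w

theorem Rep.int_induction {G : Type v} [Monoid G] {motive : Rep.{w} ℤ G → Prop}
    (of : ∀ (V : Type w) [AddCommGroup V] (ρ : Representation ℤ G V), motive (Rep.of ρ))
    (M : Rep.{w} ℤ G) : motive M := by
  obtain ⟨V, ρ⟩ := M
  rename_i h₁ h₂
  obtain rfl : h₂ = AddCommGroup.toIntModule V := Subsingleton.elim _ _
  exact of V ρ

namespace groupCohomology

variable {k G : Type u} [CommRing k] [Group G]

instance [Finite G] (N : Rep.{u} k G) [Finite N] : Finite (groupCohomology N 2) := by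
  have : Finite (cocycles₂ N) := Subtype.finite
  exact Finite.of_surjective (H2π N) ((ModuleCat.epi_iff_surjective _).1 inferInstance)

theorem card_nsmul_H2_eq_zero [Finite G] (N : Rep.{u} k G) (x : groupCohomology N 2) :
    Nat.card G • x = 0 := by
  have := Fintype.ofFinite G
  induction x using H2_induction_on with
  | h f =>
  rw [← map_nsmul, H2π_eq_zero_iff]
  refine ⟨fun g ↦ ∑ j, f (g, j), ?_⟩
  ext ⟨g, h⟩
  have hf := Finset.sum_congr (s₁ := Finset.univ) rfl
    fun j _ ↦ (mem_cocycles₂_iff f.1).1 f.2 g h j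
  have hs : ∑ j, f (g, h * j) = ∑ j, f (g, j) :=
    Fintype.sum_equiv (Equiv.mulLeft h) _ _ fun _ ↦ rfl
  simp only [Finset.sum_add_distrib, Finset.sum_const, Finset.card_univ, cocycles₂.val_eq_coe,
    hs] at hf
  simp only [d₁₂_hom_apply, map_sum]
  rw [sub_add_eq_add_sub]
  erw [← hf]
  rw [add_sub_cancel_left, ← Nat.card_eq_fintype_card]
  rfl

theorem exists_map_eq_of_exact {A B C : Rep.{u} k G} (f : A ⟶ B) (g : B ⟶ C)
    (hf : Function.Injective f.hom) (hg : Function.Surjective g.hom)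
    (hfg : ∀ y, g.hom y = 0 ↔ ∃ x, f.hom x = y) (y : groupCohomology B 2)
    (hy : (functor k G 2).map g y = 0) : ∃ x, (functor k G 2).map f x = y := by
  have w : f ≫ g = 0 := by
    refine Rep.hom_ext (Representation.IntertwiningMap.ext (LinearMap.ext fun x ↦ ?_))
    exact (hfg _).2 ⟨x, rfl⟩
  have hX : (ShortComplex.mk f g w).ShortExact :=
    { exact := by
        refine (ShortComplex.exact_map_iff_of_faithful _
          (forget₂ (Rep.{u} k G) (ModuleCat.{u} k))).1 ?_
        rw [ShortComplex.moduleCat_exact_iff]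
        exact fun y hy ↦ (hfg y).1 hy
      mono_f := (Rep.mono_iff_injective _).2 hf
      epi_g := (Rep.epi_iff_surjective _).2 hg }
  exact (ShortComplex.moduleCat_exact_iff _).1 (mapShortComplex₂_exact hX 2) y hy

theorem map_H2_eq_nsmul {A : Rep.{u} k G} (f : A ⟶ A) (n : ℕ) (hf : ∀ x, f.hom x = n • x)
    (x : groupCohomology A 2) : (functor k G 2).map f x = n • x := by
  induction x using H2_induction_on with
  | h c =>
  have := LinearMap.congr_fun (congrArg ModuleCat.Hom.hom (H2π_comp_map (MonoidHom.id G) f)) c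
  simp only [ModuleCat.hom_comp, LinearMap.comp_apply] at this
  refine this.trans ?_
  rw [← map_nsmul]
  congr 1
  exact cocycles₂_ext fun g h ↦ hf _

theorem card_torsionBy_H2_le_mul_of_exact {A B C : Rep.{u} k G} (f : A ⟶ B) (g : B ⟶ C)
    (hf : Function.Injective f.hom) (hg : Function.Surjective g.hom)
    (hfg : ∀ y, g.hom y = 0 ↔ ∃ x, f.hom x = y) [Finite (groupCohomology A 2)]
    [Finite (groupCohomology C 2)] (n : ℕ) :
    Finite (groupCohomology B 2) ∧
      Nat.card (AddSubgroup.torsionBy (groupCohomology B 2) (n : ℤ)) ≤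
        Nat.card (AddSubgroup.torsionBy (groupCohomology A 2) (n : ℤ)) *
          Nat.card (AddSubgroup.torsionBy (groupCohomology C 2) (n : ℤ)) :=
  have : Finite ((functor k G 2).obj A) := ‹Finite (groupCohomology A 2)›
  have : Finite ((functor k G 2).obj C) := ‹Finite (groupCohomology C 2)›
  AddSubgroup.card_torsionBy_le_mul_of_exact
    ((functor k G 2).map f).hom.toAddMonoidHom ((functor k G 2).map g).hom.toAddMonoidHom
    (exists_map_eq_of_exact f g hf hg hfg) n

theorem card_torsionBy_H2_le_of_divisible (A : Rep.{u} k G) (p : ℕ)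
    (hA : ∀ x : A, ∃ y : A, p • y = x)
    (hW : ∀ g, Submodule.torsionBy k A (p : k) ≤ (Submodule.torsionBy k A (p : k)).comap (A.ρ g))
    [Finite (groupCohomology (A.subrepresentation _ hW) 2)] :
    Finite (AddSubgroup.torsionBy (groupCohomology A 2) (p : ℤ)) ∧
      Nat.card (AddSubgroup.torsionBy (groupCohomology A 2) (p : ℤ)) ≤
        Nat.card (AddSubgroup.torsionBy
          (groupCohomology (A.subrepresentation _ hW) 2) (p : ℤ)) := by
  set B := A.subrepresentation _ hW
  let m : A ⟶ A := Rep.ofHom ⟨(p : k) • LinearMap.id, fun g ↦ LinearMap.ext fun x ↦ by simp⟩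
  have hm (x : A) : m.hom x = p • x := Nat.cast_smul_eq_nsmul k p x
  have hB : (functor k G 2).map (p • 𝟙 B) = 0 := by
    rw [show p • 𝟙 B = 0 from Rep.hom_ext (Representation.IntertwiningMap.ext
      (LinearMap.ext fun x ↦ ?_)), Functor.map_zero]
    refine Subtype.ext ?_
    exact (Nat.cast_smul_eq_nsmul k p x.1).symm.trans x.2
  let F : groupCohomology B 2 →+ groupCohomology A 2 :=
    ((functor k G 2).map (A.subtype _ hW)).hom.toAddMonoidHom
  have hle : AddSubgroup.torsionBy (groupCohomology A 2) (p : ℤ) ≤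
      (AddSubgroup.torsionBy (groupCohomology B 2) (p : ℤ)).map F := by
    intro y hy
    obtain ⟨x, rfl⟩ := exists_map_eq_of_exact (A.subtype _ hW) m
      (Submodule.subtype_injective _) (fun x ↦ by simpa only [hm] using hA x)
      (fun y ↦ ⟨fun hy ↦ ⟨⟨y, hy⟩, rfl⟩, by rintro ⟨x, rfl⟩; exact x.2⟩) y
      ((map_H2_eq_nsmul m p hm y).trans (AddSubgroup.torsionBy.nsmul_iff.1 hy))
    refine ⟨x, AddSubgroup.torsionBy.nsmul_iff.2 ?_, rfl⟩
    refine (map_H2_eq_nsmul (p • 𝟙 B) p (fun _ ↦ rfl) x).symm.trans ?_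
    rw [hB]
    rfl
  have hsurj : Function.Surjective
      (F.addSubgroupMap (AddSubgroup.torsionBy (groupCohomology B 2) (p : ℤ))) :=
    F.addSubgroupMap_surjective _
  have : Finite (AddSubgroup.torsionBy (groupCohomology B 2) (p : ℤ)) := Subtype.finite
  have := Finite.of_surjective _ hsurj
  exact ⟨Finite.of_injective _ (AddSubgroup.inclusion_injective hle),
    (Nat.card_le_card_of_injective _ (AddSubgroup.inclusion_injective hle)).trans
      (Nat.card_le_card_of_surjective _ hsurj)⟩

theorem finite_H2_of_finite_torsionBy [Finite G] (p : ℕ) [Fact p.Prime] (hG : IsPGroup p G)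
    (A : Rep.{u} k G) [Finite (AddSubgroup.torsionBy (groupCohomology A 2) (p : ℤ))] :
    Finite (groupCohomology A 2) := by
  obtain ⟨n, hn⟩ := hG.exists_card_eq
  have := (AddSubgroup.card_torsionBy_pow_le (groupCohomology A 2) p n).1
  refine Finite.of_injective (fun x ↦ (⟨x, ?_⟩ :
    AddSubgroup.torsionBy (groupCohomology A 2) ((p : ℤ) ^ n))) fun x y h ↦ Subtype.mk.inj h
  rw [← Nat.cast_pow, AddSubgroup.torsionBy.nsmul_iff, ← hn]
  exact card_nsmul_H2_eq_zero A x

theorem exists_invariant_addOrderOf_eq (p : ℕ) [Fact p.Prime] [Finite G] (hG : IsPGroup p G)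
    (N : Rep.{u} k G) [Finite N] (hN : p ∣ Nat.card N) :
    ∃ x : N, addOrderOf x = p ∧ ∀ g, N.ρ g x = x := by
  let : MulAction G N :=
    { smul g x := N.ρ g x
      one_smul x := by
        change N.ρ 1 x = x
        simp
      mul_smul g h x := by
        change N.ρ (g * h) x = N.ρ g (N.ρ h x)
        simp }
  have hdvd : p ∣ Nat.card (Representation.invariants N.ρ) :=
    Nat.modEq_zero_iff_dvd.1
      ((hG.card_modEq_card_fixedPoints N).symm.trans (Nat.modEq_zero_iff_dvd.2 hN))
  obtain ⟨x, hx⟩ := exists_prime_addOrderOf_dvd_card' p hdvd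
  exact ⟨x, by simpa using hx, x.2⟩

theorem card_torsionBy_H2_le_of_card_eq {G : Type} [Group G] [Finite G] (p : ℕ) [Fact p.Prime]
    (hG : IsPGroup p G) (t : ℕ) {N : Type} [AddCommGroup N] (ρ : Representation ℤ G N)
    (hN : Nat.card N = p ^ t) :
    Nat.card (AddSubgroup.torsionBy (groupCohomology (Rep.of ρ) 2) (p : ℤ)) ≤
      p ^ (rp p (groupCohomology (Rep.trivial ℤ G (ZMod p)) 2) * t) := by
  have hp : p.Prime := Fact.out
  induction t generalizing N with
  | zero =>
    have : Finite N := Nat.finite_of_card_ne_zero (by simp [hN])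
    have : Subsingleton N := (Nat.card_eq_one_iff_unique.1 (by simpa using hN)).1
    have : Subsingleton (cocycles₂ (Rep.of ρ)) := Subtype.val_injective.subsingleton
    have : Subsingleton (groupCohomology (Rep.of ρ) 2) :=
      ((ModuleCat.epi_iff_surjective (H2π (Rep.of ρ))).1 inferInstance).subsingleton
    simp
  | succ t ih =>
    have : Finite N := Nat.finite_of_card_ne_zero (by simp [hN, hp.ne_zero])
    obtain ⟨x, hx, hxG⟩ : ∃ x : N, addOrderOf x = p ∧ ∀ g, ρ g x = x :=
      exists_invariant_addOrderOf_eq p hG (Rep.of ρ) (by simp [hN, pow_succ])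
    let φ : ZMod p →ₗ[ℤ] N :=
      (ZMod.lift p ⟨zmultiplesHom N x, by simp [← hx, addOrderOf_nsmul_eq_zero]⟩).toIntLinearMap
    have hφ (n : ℤ) : φ n = n • x := by simp [φ]
    have hφG (g : G) (y : ZMod p) : ρ g (φ y) = φ y := by
      obtain ⟨n, rfl⟩ := ZMod.intCast_surjective y
      rw [hφ, map_zsmul, hxG]
    have hinj : Function.Injective φ := by
      rw [injective_iff_map_eq_zero]
      intro y hy
      obtain ⟨n, rfl⟩ := ZMod.intCast_surjective y
      rw [hφ, ← addOrderOf_dvd_iff_zsmul_eq_zero, hx] at hy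
      exact (ZMod.intCast_zmod_eq_zero_iff_dvd n p).2 hy
    have hW (g : G) : LinearMap.range φ ≤ (LinearMap.range φ).comap (ρ g) := by
      rintro _ ⟨y, rfl⟩
      exact ⟨y, (hφG g y).symm⟩
    let f : Rep.trivial ℤ G (ZMod p) ⟶ Rep.of ρ :=
      Rep.ofHom ⟨φ, fun g ↦ LinearMap.ext fun y ↦ (hφG g y).symm⟩
    have hcard : Nat.card (N ⧸ LinearMap.range φ) = p ^ t := by
      have h := (LinearMap.range φ).card_eq_card_quotient_mul_card
      rw [hN, Nat.card_congr (LinearEquiv.ofInjective φ hinj).symm.toEquiv, Nat.card_zmod,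
        pow_succ'] at h
      exact (Nat.eq_of_mul_eq_mul_left hp.pos h).symm
    have : Finite ((Rep.of ρ).quotient (LinearMap.range φ) hW) :=
      Finite.of_surjective _ (Submodule.mkQ_surjective (LinearMap.range φ))
    have : Finite (Rep.trivial ℤ G (ZMod p)) := inferInstanceAs (Finite (ZMod p))
    refine (card_torsionBy_H2_le_mul_of_exact f ((Rep.of ρ).mkQ _ hW) hinj
      (Submodule.mkQ_surjective _) (fun y ↦ Submodule.Quotient.mk_eq_zero _) p).2.trans ?_
    rw [mul_add_one, add_comm, pow_add, pow_rp]
    exact Nat.mul_le_mul_left _ (ih _ hcard)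

end groupCohomology

theorem order_bound_on_pow_torsion_of_H2
    (p : ℕ) (hp : p.Prime) (G : Type) [Group G] [Finite G] (hG : IsPGroup p G)
    (M : Rep ℤ G) (hMtors : ∀ x : M, ∃ k : ℕ, p ^ k • x = 0)
    (D : Submodule ℤ M.V)
    (hDinv : ∀ (g : G), ∀ x ∈ D, M.ρ g x ∈ D)
    (hDdiv : ∀ x ∈ D, ∃ y ∈ D, p • y = x)
    (r t : ℕ)
    (hDp : Nat.card {x : M // x ∈ D ∧ p • x = 0} = p ^ r)
    (hMD : Nat.card (M.V ⧸ D) = p ^ t)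
    (n : ℕ) (hn : 1 ≤ n) :
    Finite (AddSubgroup.torsionBy (groupCohomology M 2) ((p : ℤ) ^ n)) ∧
      Nat.card (AddSubgroup.torsionBy (groupCohomology M 2) ((p : ℤ) ^ n)) ≤
        p ^ (n * rp p (groupCohomology (Rep.trivial ℤ G (ZMod p)) 2) * (r + t)) := by
  have : Fact p.Prime := ⟨hp⟩
  induction M using Rep.int_induction with
  | of V ρ =>
  let M := Rep.of ρ
  let A := M.subrepresentation D hDinv
  let Q := M.quotient D hDinv
  have hQcard : Nat.card Q = p ^ t := hMD
  have : Finite Q := Nat.finite_of_card_ne_zero (by simp [hQcard, hp.ne_zero])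
  have hW (g : G) : Submodule.torsionBy ℤ A (p : ℤ) ≤
      (Submodule.torsionBy ℤ A (p : ℤ)).comap (A.ρ g) := fun x hx ↦ by
    rw [Submodule.mem_torsionBy_iff] at hx
    rw [Submodule.mem_comap, Submodule.mem_torsionBy_iff, ← map_zsmul, hx, map_zero]
  have hWcard : Nat.card (Submodule.torsionBy ℤ A (p : ℤ)) = p ^ r := by
    rw [← hDp]
    exact Nat.card_congr
      { toFun x := ⟨x.1.1, x.1.2, congrArg Subtype.val (AddSubgroup.torsionBy.nsmul_iff.1 x.2)⟩
        invFun x := ⟨⟨x.1, x.2.1⟩, AddSubgroup.torsionBy.nsmul_iff.2 (Subtype.ext x.2.2)⟩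
        left_inv _ := rfl
        right_inv _ := rfl }
  have : Finite (A.subrepresentation _ hW) :=
    Nat.finite_of_card_ne_zero (hWcard.trans_ne (pow_ne_zero _ hp.ne_zero))
  obtain ⟨hAfin, hA⟩ := card_torsionBy_H2_le_of_divisible A p
    (fun x ↦ by
      obtain ⟨y, hy, hyx⟩ := hDdiv x x.2
      exact ⟨⟨y, hy⟩, Subtype.ext hyx⟩) hW
  have := finite_H2_of_finite_torsionBy p hG A
  replace hA := hA.trans (card_torsionBy_H2_le_of_card_eq p hG r _ hWcard)
  have hQ := card_torsionBy_H2_le_of_card_eq p hG t Q.ρ hQcard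
  obtain ⟨hMfin, hM⟩ := card_torsionBy_H2_le_mul_of_exact (M.subtype D hDinv) (M.mkQ D hDinv)
    D.subtype_injective D.mkQ_surjective
    (fun y ↦ (Submodule.Quotient.mk_eq_zero D).trans
      ⟨fun hy ↦ ⟨⟨y, hy⟩, rfl⟩, by rintro ⟨x, rfl⟩; exact x.2⟩) p
  obtain ⟨hfin, hle⟩ := AddSubgroup.card_torsionBy_pow_le (groupCohomology M 2) p n
  refine ⟨hfin, hle.trans ?_⟩
  rw [mul_assoc, mul_comm n, pow_mul, mul_add, pow_add]
  exact Nat.pow_le_pow_left (hM.trans (Nat.mul_le_mul hA hQ)) n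
end
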